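/- Let n ≥ 3 and let F be a Finsler metric on an open set U ⊆ ℝⁿ which is of sectional flag curvature and whose Matsumoto torsion vanishes identically (M_{ijk}(x, y) = 0 for all (x, y) and all indices). Then for every x ∈ U, y ∈ ℝⁿ ∖ {0} and v ∈ ℝⁿ: (h_{ij}v^iv^j)·(I_m R^m_k v^k − 3 I_{k|0|0}v^k) = 4(R_{jk}v^jv^k)(I_k v^k), all tensors being evaluated at (x, y). -/

import Mathlib

open scoped BigOperators
open MeasureTheory

noncomputable section

namespace Paper

/-- `E n` is the model space ℝⁿ. -/
abbrev E (n : ℕ) := Fin n → ℝ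

/-- `e n i` is the `i`-th standard basis vector of ℝⁿ. -/
def e (n : ℕ) (i : Fin n) : E n := Pi.single i 1

/-- Partial derivative of `f(x,y)` in the fiber variable `y^i`. -/
def pdy (n : ℕ) (f : E n → E n → ℝ) (i : Fin n) : E n → E n → ℝ :=
  fun x y => fderiv ℝ (f x) y (e n i)

/-- Partial derivative of `f(x,y)` in the base variable `x^k`. -/
def pdx (n : ℕ) (f : E n → E n → ℝ) (k : Fin n) : E n → E n → ℝ :=
  fun x y => fderiv ℝ (fun x' => f x' y) x (e n k)

/-- The square `F²` of the metric. -/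
def F2 (n : ℕ) (F : E n → E n → ℝ) : E n → E n → ℝ := fun x y => (F x y) ^ 2

/-- Fundamental tensor `g_{ij} = ½ [F²]_{y^i y^j}`. -/
def gm (n : ℕ) (F : E n → E n → ℝ) (i j : Fin n) : E n → E n → ℝ :=
  fun x y => (1 / 2 : ℝ) * pdy n (pdy n (F2 n F) j) i x y

/-- The fundamental tensor as a matrix. -/
def gmat (n : ℕ) (F : E n → E n → ℝ) (x y : E n) : Matrix (Fin n) (Fin n) ℝ :=
  Matrix.of fun i j => gm n F i j x y

/-- The inverse fundamental tensor `g^{ij}`. -/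
def ginv (n : ℕ) (F : E n → E n → ℝ) (x y : E n) : Matrix (Fin n) (Fin n) ℝ :=
  (gmat n F x y)⁻¹

/-- `F_{y^i}`. -/
def Fy (n : ℕ) (F : E n → E n → ℝ) (i : Fin n) : E n → E n → ℝ := pdy n F i

/-- Angular metric `h_{ij} = g_{ij} - F_{y^i} F_{y^j}`. -/
def hm (n : ℕ) (F : E n → E n → ℝ) (i j : Fin n) : E n → E n → ℝ :=
  fun x y => gm n F i j x y - Fy n F i x y * Fy n F j x y

/-- Cartan tensor `C_{ijk} = ¼ [F²]_{y^i y^j y^k}`. -/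
def Cartan (n : ℕ) (F : E n → E n → ℝ) (i j k : Fin n) : E n → E n → ℝ :=
  fun x y => (1 / 4 : ℝ) * pdy n (pdy n (pdy n (F2 n F) k) j) i x y

/-- Mean Cartan tensor `I_i = g^{jk} C_{ijk}`. -/
def meanCartan (n : ℕ) (F : E n → E n → ℝ) (i : Fin n) : E n → E n → ℝ :=
  fun x y => ∑ j, ∑ k, ginv n F x y j k * Cartan n F i j k x y

/-- Matsumoto torsion `M_{ijk}`. -/
def Matsumoto (n : ℕ) (F : E n → E n → ℝ) (i j k : Fin n) : E n → E n → ℝ :=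
  fun x y => Cartan n F i j k x y -
    (1 / ((n : ℝ) + 1)) * (hm n F i j x y * meanCartan n F k x y +
      hm n F j k x y * meanCartan n F i x y + hm n F k i x y * meanCartan n F j x y)

/-- Spray coefficients `G^i = ¼ g^{il} ([F²]_{x^k y^l} y^k - [F²]_{x^l})`. -/
def Spray (n : ℕ) (F : E n → E n → ℝ) (i : Fin n) : E n → E n → ℝ :=
  fun x y => (1 / 4 : ℝ) * ∑ l, ginv n F x y i l *
    ((∑ k, pdx n (pdy n (F2 n F) l) k x y * y k) - pdx n (F2 n F) l x y)

/-- Riemann curvature `R^i_k`. -/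
def RiemUp (n : ℕ) (F : E n → E n → ℝ) (i k : Fin n) : E n → E n → ℝ :=
  fun x y =>
    2 * pdx n (Spray n F i) k x y
    - (∑ j, y j * pdx n (pdy n (Spray n F i) k) j x y)
    + 2 * (∑ j, Spray n F j x y * pdy n (pdy n (Spray n F i) k) j x y)
    - ∑ j, pdy n (Spray n F i) j x y * pdy n (Spray n F j) k x y

/-- Riemann curvature with lowered index `R_{jk} = g_{ij} R^i_k`. -/
def Rlow (n : ℕ) (F : E n → E n → ℝ) (j k : Fin n) : E n → E n → ℝ :=
  fun x y => ∑ i, gm n F i j x y * RiemUp n F i k x y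

/-- Flag curvature `K(x,y,v)`. -/
def K (n : ℕ) (F : E n → E n → ℝ) (x y v : E n) : ℝ :=
  (∑ j, ∑ k, Rlow n F j k x y * v j * v k) /
    ((F x y) ^ 2 * ∑ j, ∑ k, hm n F j k x y * v j * v k)

/-- `F` is a Finsler metric on the open set `U ⊆ ℝⁿ`. -/
structure IsFinsler (n : ℕ) (U : Set (E n)) (F : E n → E n → ℝ) : Prop where
  smooth : ContDiffOn ℝ (⊤ : ℕ∞) (fun p : E n × E n => F p.1 p.2) (U ×ˢ {y : E n | y ≠ 0})
  pos : ∀ x ∈ U, ∀ y : E n, y ≠ 0 → 0 < F x y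
  homog : ∀ x ∈ U, ∀ y : E n, y ≠ 0 → ∀ c : ℝ, 0 < c → F x (c • y) = c * F x y
  posdef : ∀ x ∈ U, ∀ y : E n, y ≠ 0 → (gmat n F x y).PosDef

/-- `F` is of sectional flag curvature: `K` only depends on the section. -/
def SectionalFlagCurv (n : ℕ) (U : Set (E n)) (F : E n → E n → ℝ) : Prop :=
  ∀ x ∈ U, ∀ y v y' v' : E n,
    LinearIndependent ℝ ![y, v] → LinearIndependent ℝ ![y', v'] →
    Submodule.span ℝ {y, v} = Submodule.span ℝ {y', v'} →
    K n F x y v = K n F x y' v'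

/-- The flag curvature is isotropic at `x`. -/
def IsotropicAt (n : ℕ) (F : E n → E n → ℝ) (x : E n) : Prop :=
  ∃ c : ℝ, ∀ y v : E n, LinearIndependent ℝ ![y, v] → K n F x y v = c

/-- The spray vector field `G = y^i ∂/∂x^i - 2G^i ∂/∂y^i` acting on a function of `(x,y)`. -/
def Gop (n : ℕ) (F f : E n → E n → ℝ) : E n → E n → ℝ :=
  fun x y => (∑ i, y i * pdx n f i x y) - 2 * ∑ i, Spray n F i x y * pdy n f i x y

/-- Dynamical derivative of a 1-index tensor. -/
def Dyn1 (n : ℕ) (F : E n → E n → ℝ) (T : Fin n → E n → E n → ℝ) (i : Fin n) :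
    E n → E n → ℝ :=
  fun x y => Gop n F (T i) x y - ∑ m, pdy n (Spray n F m) i x y * T m x y

/-- Dynamical derivative of a 2-index tensor. -/
def Dyn2 (n : ℕ) (F : E n → E n → ℝ) (T : Fin n → Fin n → E n → E n → ℝ) (i j : Fin n) :
    E n → E n → ℝ :=
  fun x y => Gop n F (T i j) x y - (∑ m, pdy n (Spray n F m) i x y * T m j x y)
    - ∑ m, pdy n (Spray n F m) j x y * T i m x y

/-- Dynamical derivative of a 3-index tensor. -/
def Dyn3 (n : ℕ) (F : E n → E n → ℝ) (T : Fin n → Fin n → Fin n → E n → E n → ℝ)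
    (i j k : Fin n) : E n → E n → ℝ :=
  fun x y => Gop n F (T i j k) x y - (∑ m, pdy n (Spray n F m) i x y * T m j k x y)
    - (∑ m, pdy n (Spray n F m) j x y * T i m k x y)
    - ∑ m, pdy n (Spray n F m) k x y * T i j m x y

/-- `y` is a polar direction at `x`: `R_{jk} = κ F² h_{jk}` for some constant `κ`. -/
def IsPolarDir (n : ℕ) (F : E n → E n → ℝ) (x y : E n) : Prop :=
  ∃ κ : ℝ, ∀ j k : Fin n, Rlow n F j k x y = κ * (F x y) ^ 2 * hm n F j k x y


/-- contraction of two index families -/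
def pr {n : ℕ} {A : Type*} [CommRing A] (f g : Fin n → A) : A := ∑ m, f m * g m

theorem pr_comm {n : ℕ} {A : Type*} [CommRing A] (f g : Fin n → A) : pr f g = pr g f := by
  simp [pr, mul_comm]

theorem pr_der {n : ℕ} {A : Type*} [CommRing A] [Algebra ℝ A] (D : Derivation ℝ A A)
    (f g : Fin n → A) :
    D (pr f g) = pr (fun m => D (f m)) g + pr f (fun m => D (g m)) := by
  simp only [pr, map_sum, Derivation.leibniz, smul_eq_mul, Finset.sum_add_distrib]
  rw [add_comm]
  congr 1
  exact Finset.sum_congr rfl fun m _ => mul_comm _ _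

theorem pr_add {n : ℕ} {A : Type*} [CommRing A] (f g h : Fin n → A) :
    pr f (fun m => g m + h m) = pr f g + pr f h := by
  simp only [pr, mul_add, Finset.sum_add_distrib]

theorem pr_sub {n : ℕ} {A : Type*} [CommRing A] (f g h : Fin n → A) :
    pr f (fun m => g m - h m) = pr f g - pr f h := by
  simp only [pr, mul_sub, Finset.sum_sub_distrib]

theorem pr_neg {n : ℕ} {A : Type*} [CommRing A] (f g : Fin n → A) :
    pr f (fun m => - g m) = - pr f g := by
  simp only [pr, mul_neg, Finset.sum_neg_distrib]

theorem pr_mul {n : ℕ} {A : Type*} [CommRing A] (f g : Fin n → A) (a : A) :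
    pr f (fun m => g m * a) = pr f g * a := by
  simp only [pr, Finset.sum_mul, mul_assoc]

theorem pr_mul' {n : ℕ} {A : Type*} [CommRing A] (f g : Fin n → A) (a : A) :
    pr f (fun m => a * g m) = a * pr f g := by
  simp only [pr, Finset.mul_sum]
  exact Finset.sum_congr rfl fun m _ => by ring

theorem pr_swap {n : ℕ} {A : Type*} [CommRing A] (f g : Fin n → A) (T : Fin n → Fin n → A) :
    pr f (fun l => pr (T l) g) = pr g (fun m => pr f (fun l => T l m)) := by
  simp only [pr, Finset.mul_sum]
  rw [Finset.sum_comm]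
  exact Finset.sum_congr rfl fun m _ => Finset.sum_congr rfl fun l _ => by ring

/-- Abstract algebraic data of a Finsler metric. -/
structure Sys (n : ℕ) (A : Type*) [CommRing A] [Algebra ℝ A] where
  Dx : Fin n → Derivation ℝ A A
  Dy : Fin n → Derivation ℝ A A
  y : Fin n → A
  G : Fin n → A
  F : A
  cyy : ∀ i j a, Dy i (Dy j a) = Dy j (Dy i a)
  cxy : ∀ i j a, Dx i (Dy j a) = Dy j (Dx i a)
  cxx : ∀ i j a, Dx i (Dx j a) = Dx j (Dx i a)
  yy : ∀ i j, Dy i (y j) = if i = j then 1 else 0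
  xy : ∀ i j, Dx i (y j) = 0
  uF : IsUnit F
  euler : ∑ i, y i * Dy i F = F
  EL : ∀ i, 2 * ∑ l, Dy l (Dy i (F ^ 2)) * G l
    = (∑ k, y k * Dx k (Dy i (F ^ 2))) - Dx i (F ^ 2)

namespace Sys

variable {n : ℕ} {A : Type*} [CommRing A] [Algebra ℝ A] (s : Sys n A)

theorem two_cancel {a b : A} (h : 2 * a = 2 * b) : a = b := by
  have h2 : algebraMap ℝ A (1/2) * 2 = 1 := by
    rw [show (2 : A) = algebraMap ℝ A 2 from (map_ofNat (algebraMap ℝ A) 2).symm, ← map_mul]; norm_num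
  calc a = algebraMap ℝ A (1/2) * 2 * a := by rw [h2, one_mul]
    _ = algebraMap ℝ A (1/2) * 2 * b := by rw [mul_assoc, h, mul_assoc]
    _ = b := by rw [h2, one_mul]

/-- spray derivation -/
def S : Derivation ℝ A A := (∑ m, s.y m • s.Dx m) - (2 : A) • ∑ m, s.G m • s.Dy m

theorem S_apply (a : A) :
    s.S a = pr s.y (fun m => s.Dx m a) - 2 * pr s.G (fun m => s.Dy m a) := by
  have key : ∀ (c : Fin n → A) (D : Fin n → Derivation ℝ A A),
      (∑ m, c m • D m) a = pr c (fun m => D m a) := by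
    intro c D
    simp only [pr]
    rw [← Derivation.coeFnAddMonoidHom_apply, map_sum, Finset.sum_apply]
    rfl
  simp [S, key]

/-- `∂_i G^m` -/
def N (i : Fin n) : Fin n → A := fun m => s.Dy i (s.G m)
def G2 (i j : Fin n) : Fin n → A := fun m => s.Dy i (s.Dy j (s.G m))
def G3 (i j k : Fin n) : Fin n → A := fun m => s.Dy i (s.Dy j (s.Dy k (s.G m)))
def Q : A := s.F ^ 2
def Q1 : Fin n → A := fun m => s.Dy m s.Q
def Q2 (i : Fin n) : Fin n → A := fun m => s.Dy i (s.Dy m s.Q)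
def Q3 (i j : Fin n) : Fin n → A := fun m => s.Dy i (s.Dy j (s.Dy m s.Q))

theorem Dy_N (i j : Fin n) : (fun m => s.Dy i (s.N j m)) = s.G2 i j := rfl
theorem Dy_G2 (i j k : Fin n) : (fun m => s.Dy i (s.G2 j k m)) = s.G3 i j k := rfl
theorem Dy_Q1 (i : Fin n) : (fun m => s.Dy i (s.Q1 m)) = s.Q2 i := rfl
theorem Dy_Q2 (i j : Fin n) : (fun m => s.Dy i (s.Q2 j m)) = s.Q3 i j := rfl

theorem G2_comm (i j : Fin n) : s.G2 i j = s.G2 j i := by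
  funext m; exact s.cyy _ _ _
theorem G3_comm12 (i j k : Fin n) : s.G3 i j k = s.G3 j i k := by
  funext m; exact s.cyy _ _ _
theorem G3_comm23 (i j k : Fin n) : s.G3 i j k = s.G3 i k j := by
  funext m; simp only [G3]; rw [s.cyy j k]
theorem Q3_comm (i j : Fin n) : s.Q3 i j = s.Q3 j i := by
  funext m; exact s.cyy _ _ _
theorem Q2_symm (i j : Fin n) : s.Q2 i j = s.Q2 j i := s.cyy _ _ _

theorem Dy_S (i : Fin n) (a : A) :
    s.Dy i (s.S a) = s.S (s.Dy i a) + s.Dx i a - 2 * pr (s.N i) (fun m => s.Dy m a) := by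
  rw [S_apply, S_apply]
  simp only [map_sub, Derivation.leibniz, pr_der, smul_eq_mul]
  have h0 : s.Dy i (2 : A) = 0 := by
    have := (s.Dy i).map_natCast 2
    simpa using this
  have h1 : pr (fun m => s.Dy i (s.y m)) (fun m => s.Dx m a) = s.Dx i a := by
    simp [pr, s.yy]
  rw [h1, h0]
  have hN : s.N i = fun m => s.Dy i (s.G m) := rfl
  rw [hN]
  simp only [← s.cxy, s.cyy i]
  ring

theorem Dx_S (i : Fin n) (a : A) :
    s.Dx i (s.S a) = s.S (s.Dx i a) - 2 * pr (fun m => s.Dx i (s.G m)) (fun m => s.Dy m a) := by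
  rw [S_apply, S_apply]
  simp only [map_sub, Derivation.leibniz, pr_der, smul_eq_mul]
  have h0 : s.Dx i (2 : A) = 0 := by
    have := (s.Dx i).map_natCast 2
    simpa using this
  have h1 : pr (fun m => s.Dx i (s.y m)) (fun m => s.Dx m a) = 0 := by
    simp [pr, s.xy]
  rw [h1, h0]
  simp only [s.cxy, s.cxx i]
  ring

theorem euler1 : pr s.y s.Q1 = 2 * s.Q := by
  have h := s.euler
  have : pr s.y s.Q1 = 2 * s.F * ∑ i, s.y i * s.Dy i s.F := by
    simp only [pr, Q1, Q, pow_two, Derivation.leibniz, smul_eq_mul, Finset.mul_sum]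
    exact Finset.sum_congr rfl fun m _ => by ring
  rw [this, h, Q]; ring

theorem pr_yy (i : Fin n) (f : Fin n → A) : pr (fun m => s.Dy i (s.y m)) f = f i := by
  simp [pr, s.yy]

theorem two_der (D : Derivation ℝ A A) (a : A) : D (2 * a) = 2 * D a := by
  have h0 : D (2 : A) = 0 := by
    have := D.map_natCast 2
    simpa using this
  rw [Derivation.leibniz, h0]; simp

theorem euler2 (i : Fin n) : pr s.y (s.Q2 i) = s.Q1 i := by
  have h := congrArg (s.Dy i) s.euler1
  rw [pr_der, pr_yy, Dy_Q1, two_der] at h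
  simp only [Q1] at h ⊢
  linear_combination h

theorem euler3 (i j : Fin n) : pr s.y (s.Q3 i j) = 0 := by
  have h := congrArg (s.Dy i) (s.euler2 j)
  rw [pr_der, pr_yy, Dy_Q2] at h
  simp only [Q1, Q2] at h ⊢
  rw [s.cyy i j] at h
  linear_combination h

theorem eulerx (i : Fin n) : pr s.y (fun m => s.Dx i (s.Q1 m)) = 2 * s.Dx i s.Q := by
  have h := congrArg (s.Dx i) s.euler1
  rw [pr_der, two_der] at h
  have h1 : pr (fun m => s.Dx i (s.y m)) s.Q1 = 0 := by
    simp [pr, s.xy]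
  rw [h1] at h
  linear_combination h

theorem SQ1 (i : Fin n) : s.S (s.Q1 i) = s.Dx i s.Q := by
  have h := s.EL i
  rw [S_apply]
  have h1 : pr s.G (fun m => s.Dy m (s.Q1 i)) = ∑ l, s.Dy l (s.Dy i (s.F ^ 2)) * s.G l := by
    rw [pr_comm]; rfl
  have h2 : pr s.y (fun m => s.Dx m (s.Q1 i)) = ∑ k, s.y k * s.Dx k (s.Dy i (s.F ^ 2)) := rfl
  rw [h1, h2, h, Q]; ring

theorem SQ : s.S s.Q = 0 := by
  have h1 : pr s.y (fun i => s.S (s.Q1 i)) = pr s.y (fun i => s.Dx i s.Q) := by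
    simp only [SQ1]
  simp only [S_apply] at h1
  rw [pr_sub] at h1
  have h2 : pr s.y (fun i => pr s.y (fun m => s.Dx m (s.Q1 i)))
      = 2 * pr s.y (fun m => s.Dx m s.Q) := by
    have := pr_swap s.y s.y (fun l m => s.Dx l (s.Q1 m))
    rw [← pr_mul' , ← funext fun m => s.eulerx m]
    rw [← this]
    congr 1; funext i; rw [pr_comm]
  have h3 : pr s.y (fun i => 2 * pr s.G (fun m => s.Dy m (s.Q1 i)))
      = 2 * pr s.G s.Q1 := by
    rw [pr_mul']
    congr 1
    have := pr_swap s.G s.y (fun l => s.Q2 l)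
    simp only [euler2, pr_comm (s.Q2 _) s.y] at this
    exact this.symm
  rw [h2, h3] at h1
  rw [S_apply]
  have : (fun m => s.Dy m s.Q) = s.Q1 := rfl
  rw [this]
  linear_combination h1

theorem DxQ (i : Fin n) : s.Dx i s.Q = pr (s.N i) s.Q1 := by
  have h := s.Dy_S i s.Q
  rw [SQ, map_zero] at h
  have h1 := s.SQ1 i
  have h2 : s.Dy i s.Q = s.Q1 i := rfl
  have h3 : (fun m => s.Dy m s.Q) = s.Q1 := rfl
  rw [h2, h1, h3] at h
  apply two_cancel
  linear_combination -h

theorem SQ1' (i : Fin n) : s.S (s.Q1 i) = pr (s.N i) s.Q1 := by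
  rw [SQ1, DxQ]

theorem DxQ1 (i j : Fin n) :
    s.Dx j (s.Q1 i) = pr (s.G2 i j) s.Q1 + pr (s.N j) (s.Q2 i) := by
  simp only [Q1]
  rw [s.cxy, DxQ, pr_der, Dy_N, Dy_Q1]

theorem Q2_as (i : Fin n) : (fun m => s.Dy m (s.Q1 i)) = s.Q2 i := by
  funext m; exact s.cyy _ _ _

theorem Q3_as (i j : Fin n) : (fun m => s.Dy m (s.Q2 j i)) = s.Q3 i j := by
  funext m; simp only [Q2, Q3]; rw [s.cyy m j, s.cyy m i, s.cyy j i]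

theorem SQ2 (i j : Fin n) :
    s.S (s.Q2 j i) = pr (s.N i) (s.Q2 j) + pr (s.N j) (s.Q2 i) := by
  have h := s.Dy_S j (s.Q1 i)
  rw [SQ1', pr_der, Dy_N, Dy_Q1, DxQ1, Q2_as, G2_comm] at h
  have : s.Dy j (s.Q1 i) = s.Q2 j i := rfl
  rw [this] at h
  linear_combination -h

theorem DxQ2 (i j k : Fin n) :
    s.Dx k (s.Q2 j i) = pr (s.G3 i j k) s.Q1 + pr (s.G2 i k) (s.Q2 j) + pr (s.G2 j k) (s.Q2 i)
      + pr (s.N k) (s.Q3 i j) := by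
  have : s.Q2 j i = s.Dy j (s.Q1 i) := rfl
  rw [this, s.cxy, DxQ1, map_add, pr_der, pr_der, Dy_G2, Dy_N, Dy_Q1, Dy_Q2, G3_comm12, Q3_comm]
  ring

theorem SQ3 (i j k : Fin n) :
    s.S (s.Q3 k j i) = pr (s.N i) (s.Q3 j k) + pr (s.N j) (s.Q3 i k) + pr (s.N k) (s.Q3 i j)
      - pr (s.G3 i j k) s.Q1 := by
  have h := s.Dy_S k (s.Q2 j i)
  rw [SQ2, map_add, pr_der, pr_der, Dy_N, Dy_N, Dy_Q2, Dy_Q2, DxQ2, Q3_as,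
    G2_comm _ k i, G2_comm _ k j, Q3_comm _ k j, Q3_comm _ k i] at h
  have : s.Dy k (s.Q2 j i) = s.Q3 k j i := rfl
  rw [this] at h
  linear_combination -h

/-- curvature -/
def R (k m : Fin n) : A :=
  2 * s.Dx k (s.G m) - s.S (s.N k m) - pr (fun l => s.N l m) (s.N k)

theorem Q1R (k : Fin n) : pr s.Q1 (s.R k) = 0 := by
  have h1 := s.Dx_S k s.Q
  rw [SQ, map_zero, DxQ, pr_der] at h1
  have h3 : (fun m => s.Dy m s.Q) = s.Q1 := rfl
  have h4 := pr_swap (s.N k) s.Q1 (fun l m => s.N l m)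
  have h5 : (fun m => s.S (s.Q1 m)) = (fun l => pr (s.N l) s.Q1) := funext fun m => s.SQ1' m
  rw [h3, h5] at h1
  have h6 : pr s.Q1 (s.R k) = 2 * pr s.Q1 (fun m => s.Dx k (s.G m))
      - pr s.Q1 (fun m => s.S (s.N k m)) - pr s.Q1 (fun m => pr (fun l => s.N l m) (s.N k)) := by
    unfold R
    rw [pr_sub, pr_sub, pr_mul']
  rw [h6]
  have h7 : (fun m => pr (fun l => s.N l m) (s.N k)) = (fun m => pr (s.N k) (fun l => s.N l m)) :=
    funext fun m => pr_comm _ _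
  rw [h7, ← h4]
  rw [pr_comm _ s.Q1, pr_comm (fun m => s.Dx k (s.G m))] at h1
  linear_combination h1

theorem DyR (j k m : Fin n) : s.Dy j (s.R k m) =
    2 * s.Dx k (s.N j m) - s.S (s.G2 j k m) - s.Dx j (s.N k m)
    + 2 * pr (s.N j) (fun l => s.G2 l k m) - pr (fun l => s.G2 j l m) (s.N k)
    - pr (fun l => s.N l m) (s.G2 j k) := by
  unfold R
  rw [map_sub, map_sub, two_der, Dy_S, pr_der, ← s.cxy, Dy_N]
  have : s.Dy j (s.N k m) = s.G2 j k m := rfl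
  rw [this]
  simp only [N, G2]
  ring

theorem DyDyR (i j k m : Fin n) : s.Dy i (s.Dy j (s.R k m)) =
    2 * s.Dx k (s.G2 i j m) - s.S (s.G3 i j k m) - s.Dx i (s.G2 j k m)
    + 2 * pr (s.N i) (fun l => s.G3 l j k m) - s.Dx j (s.G2 i k m)
    + 2 * pr (s.G2 i j) (fun l => s.G2 l k m) + 2 * pr (s.N j) (fun l => s.G3 i l k m)
    - pr (fun l => s.G3 i j l m) (s.N k) - pr (fun l => s.G2 j l m) (s.G2 i k)
    - pr (fun l => s.G2 i l m) (s.G2 j k) - pr (fun l => s.N l m) (s.G3 i j k) := by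
  rw [DyR]
  simp only [map_sub, map_add, two_der, Dy_S, pr_der, Dy_N, Dy_G2]
  simp only [← s.cxy]
  simp only [N, G2, G3]
  ring

/-- the symmetric part of `∂∂R` -/
def QQ (i j k m : Fin n) : A :=
  - s.S (s.G3 i j k m) + pr (s.N i) (fun l => s.G3 l j k m) + pr (s.N j) (fun l => s.G3 i l k m)
   + pr (s.N k) (fun l => s.G3 i j l m) - pr (fun l => s.N l m) (s.G3 i j k)

theorem cycR (i j k m : Fin n) :
    s.Dy i (s.Dy j (s.R k m)) + s.Dy j (s.Dy k (s.R i m)) + s.Dy k (s.Dy i (s.R j m))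
      = 3 * s.QQ i j k m := by
  rw [DyDyR, DyDyR, DyDyR, QQ]
  have e1 : s.G3 j k i = s.G3 i j k := by rw [s.G3_comm23 j k i, s.G3_comm12 j i k]
  have e2 : s.G3 k i j = s.G3 i j k := by rw [s.G3_comm12 k i j, s.G3_comm23 i k j]
  have f1 : ∀ l, s.G3 l k i = s.G3 i l k := fun l => by
    rw [s.G3_comm23 l k i, s.G3_comm12 l i k]
  have f2 : ∀ l, s.G3 j l i = s.G3 i j l := fun l => by
    rw [s.G3_comm23 j l i, s.G3_comm12 j i l]
  have f3 : ∀ l, s.G3 j k l = s.G3 l j k := fun l => by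
    rw [s.G3_comm23 j k l, s.G3_comm12 j l k]
  have f4 : ∀ l, s.G3 l i j = s.G3 i j l := fun l => by
    rw [s.G3_comm12 l i j, s.G3_comm23 i l j]
  have f5 : ∀ l, s.G3 k l j = s.G3 l j k := fun l => by
    rw [s.G3_comm12 k l j, s.G3_comm23 l k j]
  have f6 : ∀ l, s.G3 k i l = s.G3 i l k := fun l => by
    rw [s.G3_comm12 k i l, s.G3_comm23 i k l]
  simp only [e1, e2, f1, f2, f3, f4, f5, f6, s.G2_comm j i, s.G2_comm k i, s.G2_comm k j]
  have g1 : ∀ l a, s.G2 l a = s.G2 a l := fun l a => s.G2_comm l a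
  rw [funext fun l => congrFun (g1 l k) m, funext fun l => congrFun (g1 l j) m,
    funext fun l => congrFun (g1 l i) m]
  rw [pr_comm _ (s.N k), pr_comm _ (s.N i), pr_comm _ (s.N j), pr_comm _ (s.G2 i k),
    pr_comm _ (s.G2 j k), pr_comm (fun l => s.G2 k l m)]
  ring

def dyn1 (T : Fin n → A) (i : Fin n) : A := s.S (T i) - pr (s.N i) T
def dyn3 (T : Fin n → Fin n → Fin n → A) (i j k : Fin n) : A :=
  s.S (T i j k) - pr (s.N i) (fun m => T m j k) - pr (s.N j) (fun m => T i m k)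
   - pr (s.N k) (fun m => T i j m)

theorem Q3_rot (i j k : Fin n) : s.Q3 i j k = s.Q3 j k i := by
  simp only [Q3]; rw [s.cyy i j, s.cyy i k]

theorem dyn3_Q3 : s.dyn3 s.Q3 = fun i j k => - pr (s.G3 i j k) s.Q1 := by
  funext i j k
  have h := s.SQ3 k j i
  have h1 : (fun m => s.Q3 m j k) = s.Q3 j k := by
    funext m; exact s.Q3_rot m j k
  have h2 : (fun m => s.Q3 i m k) = s.Q3 k i := by
    funext m; rw [s.Q3_rot k i m]
  have h3 : s.G3 i j k = s.G3 k j i := by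
    rw [s.G3_comm12 i j k, s.G3_comm23 j i k, s.G3_comm12 j k i]
  rw [dyn3, h, h1, h2, h3, s.Q3_comm k j, s.Q3_comm j i]
  ring

theorem dyn33_Q3 (i j k : Fin n) : s.dyn3 (s.dyn3 s.Q3) i j k = pr s.Q1 (s.QQ i j k) := by
  rw [dyn3_Q3]
  simp only [dyn3]
  rw [map_neg, pr_der, pr_neg, pr_neg, pr_neg]
  rw [pr_swap (s.N i), pr_swap (s.N j), pr_swap (s.N k)]
  have h5 : (fun m => s.S (s.Q1 m)) = (fun l => pr (s.N l) s.Q1) := funext fun m => s.SQ1' m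
  rw [h5, pr_swap (s.G3 i j k)]
  unfold QQ
  rw [pr_sub, pr_add, pr_add, pr_add, pr_neg]
  rw [pr_comm _ s.Q1]
  have h7 : (fun m => pr (fun l => s.N l m) (s.G3 i j k))
    = (fun m => pr (s.G3 i j k) (fun l => s.N l m)) := funext fun m => pr_comm _ _
  rw [h7]
  ring

theorem Q1ddR (i j k : Fin n) : pr s.Q1 (fun m => s.Dy i (s.Dy j (s.R k m))) =
    - (pr (s.Q3 i j) (s.R k) + pr (s.Q2 i) (fun m => s.Dy j (s.R k m))
      + pr (s.Q2 j) (fun m => s.Dy i (s.R k m))) := by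
  have h := congrArg (fun a => s.Dy i (s.Dy j a)) (s.Q1R k)
  simp only [map_zero, pr_der, Dy_Q1, map_add, Dy_Q2] at h
  linear_combination h

def P (i j k : Fin n) : A :=
  - (pr (s.Q3 i j) (s.R k) + pr (s.Q2 i) (fun m => s.Dy j (s.R k m))
      + pr (s.Q2 j) (fun m => s.Dy i (s.R k m)))

theorem main1 (i j k : Fin n) :
    3 * s.dyn3 (s.dyn3 s.Q3) i j k = s.P i j k + s.P j k i + s.P k i j := by
  rw [dyn33_Q3]
  unfold P
  rw [← Q1ddR, ← Q1ddR, ← Q1ddR, ← pr_mul', ← pr_add, ← pr_add]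
  congr 1
  funext m
  rw [cycR]

/-- angular metric, times 2: `2 h_ij = Q_ij - 2 F_i F_j` -/
def H (i j : Fin n) : A := s.Q2 i j - 2 * (s.Dy i s.F * s.Dy j s.F)

theorem H_symm (i j : Fin n) : s.H i j = s.H j i := by
  simp only [H]; rw [Q2_symm]; ring

theorem Q1F (i : Fin n) : s.Q1 i = 2 * s.F * s.Dy i s.F := by
  simp only [Q1, Q, pow_two, Derivation.leibniz, smul_eq_mul]; ring

theorem SF : s.S s.F = 0 := by
  have h := s.SQ
  simp only [Q, pow_two, Derivation.leibniz, smul_eq_mul] at h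
  have h1 : s.F * s.S s.F = s.F * 0 := by
    apply two_cancel; linear_combination h
  exact s.uF.mul_left_cancel h1

theorem DxF (i : Fin n) : s.Dx i s.F = pr (s.N i) (fun m => s.Dy m s.F) := by
  have h := s.DxQ i
  have h0 : s.Q1 = fun m => 2 * s.F * s.Dy m s.F := funext fun m => s.Q1F m
  rw [h0, pr_mul'] at h
  simp only [Q, pow_two, Derivation.leibniz, smul_eq_mul] at h
  apply s.uF.mul_left_cancel
  apply two_cancel; linear_combination h

theorem SF1 (i : Fin n) : s.S (s.Dy i s.F) = pr (s.N i) (fun m => s.Dy m s.F) := by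
  have h := s.Dy_S i s.F
  rw [SF, map_zero, DxF] at h
  linear_combination -h

theorem SH (i j : Fin n) : s.S (s.H i j) = pr (s.N i) (fun m => s.H m j)
    + pr (s.N j) (fun m => s.H i m) := by
  have h1 : (fun m => s.H m j) = (fun m => s.H j m) := funext fun m => s.H_symm m j
  rw [h1]
  simp only [H]
  rw [pr_sub, pr_sub, pr_mul', pr_mul', pr_mul', pr_mul', map_sub, two_der, Derivation.leibniz,
    SF1, SF1, SQ2]
  simp only [smul_eq_mul]
  change pr (s.N j) (s.Q2 i) + pr (s.N i) (s.Q2 j) - _ = pr (s.N i) (s.Q2 j) - _ +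
    (pr (s.N j) (s.Q2 i) - _)
  ring

def sym (T : Fin n → A) (i j k : Fin n) : A := s.H i j * T k + s.H j k * T i + s.H k i * T j

theorem dyn3_sym (T : Fin n → A) : s.dyn3 (s.sym T) = s.sym (s.dyn1 T) := by
  funext i j k
  simp only [dyn3, sym, dyn1]
  rw [pr_add, pr_add, pr_add, pr_add, pr_add, pr_add]
  simp only [pr_mul, pr_mul']
  simp only [map_add, Derivation.leibniz, smul_eq_mul, SH]
  ring

theorem dyn3_smul (c : ℝ) (T : Fin n → Fin n → Fin n → A) :
    s.dyn3 (fun i j k => c • T i j k) = fun i j k => c • s.dyn3 T i j k := by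
  funext i j k
  have : ∀ (f g : Fin n → A), pr f (fun m => c • g m) = c • pr f g := by
    intro f g
    simp only [pr, mul_smul_comm, Finset.smul_sum]
  have h3 := this (s.N k) (T i j)
  have h4 : s.S (c • T i j k) = c • s.S (T i j k) := Derivation.map_smul _ _ _
  simp only [dyn3, this, smul_sub]
  rw [h4]

theorem main2 (c : ℝ) (T : Fin n → A) (h : ∀ i j k, s.Q3 i j k = c • s.sym T i j k)
    (i j k : Fin n) :
    (3 * c) • s.sym (s.dyn1 (s.dyn1 T)) i j k = s.P i j k + s.P j k i + s.P k i j := by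
  rw [← main1]
  have : s.Q3 = fun i j k => c • s.sym T i j k := by funext i j k; exact h i j k
  rw [this, dyn3_smul, dyn3_smul, dyn3_sym, dyn3_sym, mul_smul]
  rw [Algebra.smul_def (3 : ℝ), map_ofNat]

end Sys

section Analysis
open scoped ContDiff
open Filter Topology

variable {V : Type*} [NormedAddCommGroup V] [NormedSpace ℝ V]

open Classical in
/-- extension by zero -/
def extz (W : Set V) (a : W → ℝ) : V → ℝ := fun p => if h : p ∈ W then a ⟨p, h⟩ else 0

theorem extz_apply (W : Set V) (a : W → ℝ) (p : W) : extz W a p = a p := by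
  simp [extz]

theorem extz_of_mem (W : Set V) (a : W → ℝ) {p : V} (hp : p ∈ W) : extz W a p = a ⟨p, hp⟩ := by
  simp [extz, hp]

/-- a function on `W` given by a smooth formula -/
theorem smooth_of (W : Set V) (a : W → ℝ) (f : V → ℝ) (hf : ContDiffOn ℝ (⊤ : ℕ∞) f W)
    (h : ∀ p : W, a p = f p) : ContDiffOn ℝ (⊤ : ℕ∞) (extz W a) W :=
  hf.congr fun p hp => by rw [extz_of_mem W a hp, h]

/-- the algebra of smooth functions on `W` -/
def SA (W : Set V) : Subalgebra ℝ (W → ℝ) where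
  carrier := {a | ContDiffOn ℝ (⊤ : ℕ∞) (extz W a) W}
  mul_mem' := by
    intro a b ha hb
    exact smooth_of W _ _ (ContDiffOn.mul ha hb) fun p => by simp [extz_apply]
  add_mem' := by
    intro a b ha hb
    exact smooth_of W _ _ (ContDiffOn.add ha hb) fun p => by simp [extz_apply]
  algebraMap_mem' := by
    intro r
    exact smooth_of W _ (fun _ => r) contDiffOn_const fun p => by simp

theorem SA_smooth {W : Set V} (a : SA W) : ContDiffOn ℝ (⊤ : ℕ∞) (extz W a.1) W := a.2

theorem SA_diff {W : Set V} (hW : IsOpen W) (a : SA W) (p : W) :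
    ContDiffAt ℝ (⊤ : ℕ∞) (extz W a.1) p :=
  (SA_smooth a).contDiffAt (hW.mem_nhds p.2)

theorem SA_differentiable {W : Set V} (hW : IsOpen W) (a : SA W) (p : W) :
    DifferentiableAt ℝ (extz W a.1) p :=
  (SA_diff hW a p).differentiableAt (by simp)

theorem fderiv_of {W : Set V} (hW : IsOpen W) (a : W → ℝ) (f : V → ℝ)
    (h : ∀ p : W, a p = f p) (p : W) : fderiv ℝ (extz W a) p = fderiv ℝ f p := by
  apply Filter.EventuallyEq.fderiv_eq
  filter_upwards [hW.mem_nhds p.2] with q hq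
  rw [extz_of_mem W a hq, h]

/-- directional derivative as a derivation -/
def dd {W : Set V} (hW : IsOpen W) (w : V) : Derivation ℝ (SA W) (SA W) :=
  Derivation.mk'
    { toFun := fun a => ⟨fun p => fderiv ℝ (extz W a.1) p w, by
        refine smooth_of W _ (fun p => fderiv ℝ (extz W a.1) p w) ?_ fun p => rfl
        have h := (SA_smooth a).fderiv_of_isOpen (m := (⊤ : ℕ∞)) hW (by simp)
        exact h.clm_apply contDiffOn_const⟩
      map_add' := by
        intro a b
        apply Subtype.ext
        funext p
        change fderiv ℝ (extz W (a.1 + b.1)) p w =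
          fderiv ℝ (extz W a.1) p w + fderiv ℝ (extz W b.1) p w
        rw [fderiv_of hW (a.1 + b.1) (extz W a.1 + extz W b.1) (fun p => by simp [extz_apply]) p,
          fderiv_add (SA_differentiable hW a p) (SA_differentiable hW b p)]
        rfl
      map_smul' := by
        intro r a
        apply Subtype.ext
        funext p
        change fderiv ℝ (extz W (r • a.1)) p w = r • fderiv ℝ (extz W a.1) p w
        rw [fderiv_of hW (r • a.1) (r • extz W a.1) (fun p => by simp [extz_apply]) p,
          fderiv_const_smul (SA_differentiable hW a p)]
        rfl }
    (by
      intro a b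
      apply Subtype.ext
      funext p
      change fderiv ℝ (extz W (a.1 * b.1)) p w =
          a.1 p * fderiv ℝ (extz W b.1) p w + b.1 p * fderiv ℝ (extz W a.1) p w
      rw [fderiv_of hW (a.1 * b.1) (extz W a.1 * extz W b.1) (fun p => by simp [extz_apply]) p,
          fderiv_mul (SA_differentiable hW a p) (SA_differentiable hW b p)]
      simp [extz_apply])

theorem dd_apply {W : Set V} (hW : IsOpen W) (w : V) (a : SA W) (p : W) :
    (dd hW w a).1 p = fderiv ℝ (extz W a.1) p w := rfl

theorem dd_of {W : Set V} (hW : IsOpen W) (w : V) (a : SA W) (f : V → ℝ)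
    (h : ∀ p : W, a.1 p = f p) (p : W) : (dd hW w a).1 p = fderiv ℝ f p w := by
  rw [dd_apply, fderiv_of hW a.1 f h]

theorem dd_comm {W : Set V} (hW : IsOpen W) (u w : V) (a : SA W) :
    dd hW u (dd hW w a) = dd hW w (dd hW u a) := by
  apply Subtype.ext
  funext p
  have key : ∀ u w : V, (dd hW u (dd hW w a)).1 p
      = fderiv ℝ (fderiv ℝ (extz W a.1)) p u w := by
    intro u w
    rw [dd_of hW u (dd hW w a) (fun q => fderiv ℝ (extz W a.1) q w) (fun p => rfl) p]
    have hd : DifferentiableAt ℝ (fderiv ℝ (extz W a.1)) p :=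
      ((SA_diff hW a p).fderiv_right (m := 1) (by norm_cast)).differentiableAt
        (by simp)
    rw [fderiv_clm_apply hd (differentiableAt_const w)]
    simp
  rw [key, key]
  have hs : IsSymmSndFDerivAt ℝ (extz W a.1) p :=
    (SA_diff hW a p).isSymmSndFDerivAt (by simp; norm_cast)
  exact hs u w

theorem SA_isUnit {W : Set V} (a : SA W) (h : ∀ p, a.1 p ≠ 0) : IsUnit a := by
  have hs : (fun p => (a.1 p)⁻¹) ∈ SA W := by
    refine smooth_of W _ (fun p => (extz W a.1 p)⁻¹) ((SA_smooth a).inv ?_) ?_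
    · intro p hp; rw [extz_of_mem W _ hp]; exact h _
    · intro p; rw [extz_apply]
  refine IsUnit.of_mul_eq_one ⟨_, hs⟩ ?_
  apply Subtype.ext
  funext p
  exact mul_inv_cancel₀ (h p)

/-- evaluation -/
def ev {W : Set V} (p : W) : SA W →ₐ[ℝ] ℝ := (Pi.evalAlgHom ℝ (fun _ : W => ℝ) p).comp (SA W).val

theorem ev_apply {W : Set V} (p : W) (a : SA W) : ev p a = a.1 p := rfl

theorem SA_ext {W : Set V} {a b : SA W} (h : ∀ p, ev p a = ev p b) : a = b :=
  Subtype.ext (funext h)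

end Analysis

section Rep
variable {n : ℕ} {W : Set (E n × E n)}

/-- the function `f` is represented by `a` on `W` -/
def Rep (f : E n → E n → ℝ) (a : SA W) : Prop :=
  ∀ p : W, f p.1.1 p.1.2 = ev p a

theorem Rep.pdy (hW : IsOpen W) {f : E n → E n → ℝ} {a : SA W} (h : Rep f a) (i : Fin n) :
    Rep (pdy n f i) (dd hW ((0 : E n), e n i) a) := by
  intro p
  rw [ev_apply, dd_of hW _ a (fun q => f q.1 q.2) (fun p => (h p).symm)]
  have hd : DifferentiableAt ℝ (fun q : E n × E n => f q.1 q.2) (p.1.1, p.1.2) := by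
    have := SA_differentiable hW a p
    apply this.congr_of_eventuallyEq
    filter_upwards [hW.mem_nhds p.2] with q hq
    rw [extz_of_mem W _ hq]; exact h ⟨q, hq⟩
  have h1 := hd.hasFDerivAt.comp p.1.2 (hasFDerivAt_prodMk_right p.1.1 p.1.2)
  have h2 := h1.fderiv
  simp only [Function.comp_def] at h2
  simp only [Paper.pdy]
  change fderiv ℝ (fun y => f p.1.1 y) p.1.2 (e n i) = _
  rw [h2]
  simp

theorem Rep.pdx (hW : IsOpen W) {f : E n → E n → ℝ} {a : SA W} (h : Rep f a) (i : Fin n) :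
    Rep (pdx n f i) (dd hW (e n i, (0 : E n)) a) := by
  intro p
  rw [ev_apply, dd_of hW _ a (fun q => f q.1 q.2) (fun p => (h p).symm)]
  have hd : DifferentiableAt ℝ (fun q : E n × E n => f q.1 q.2) (p.1.1, p.1.2) := by
    have := SA_differentiable hW a p
    apply this.congr_of_eventuallyEq
    filter_upwards [hW.mem_nhds p.2] with q hq
    rw [extz_of_mem W _ hq]; exact h ⟨q, hq⟩
  have h1 := hd.hasFDerivAt.comp p.1.1 (hasFDerivAt_prodMk_left (𝕜 := ℝ) p.1.1 p.1.2)
  have h2 := h1.fderiv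
  simp only [Function.comp_def] at h2
  simp only [Paper.pdx]
  rw [h2]
  simp

/-- fibre coordinate -/
def yc (W : Set (E n × E n)) (i : Fin n) : SA W :=
  ⟨fun p => p.1.2 i, by
    refine smooth_of W _ (fun q => q.2 i) ?_ fun p => rfl
    fun_prop⟩

theorem yc_ev (i : Fin n) (p : W) : ev p (yc W i) = p.1.2 i := rfl

theorem yc_y (hW : IsOpen W) (i j : Fin n) :
    dd hW ((0 : E n), e n i) (yc W j) = if i = j then 1 else 0 := by
  apply SA_ext
  intro p
  rw [ev_apply, dd_of hW _ (yc W j) (fun q => q.2 j) (fun p => rfl)]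
  have : HasFDerivAt (fun q : E n × E n => q.2 j)
      ((ContinuousLinearMap.proj j).comp (ContinuousLinearMap.snd ℝ (E n) (E n))) p.1 :=
    ((ContinuousLinearMap.proj (R := ℝ) (φ := fun _ : Fin n => ℝ) j).comp
      (ContinuousLinearMap.snd ℝ (E n) (E n))).hasFDerivAt
  rw [this.fderiv]
  by_cases hij : i = j
  · subst hij; simp [e]
  · simp [e, hij, Ne.symm hij]

theorem yc_x (hW : IsOpen W) (i j : Fin n) :
    dd hW (e n i, (0 : E n)) (yc W j) = 0 := by
  apply SA_ext
  intro p
  rw [ev_apply, dd_of hW _ (yc W j) (fun q => q.2 j) (fun p => rfl)]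
  have : HasFDerivAt (fun q : E n × E n => q.2 j)
      ((ContinuousLinearMap.proj j).comp (ContinuousLinearMap.snd ℝ (E n) (E n))) p.1 :=
    ((ContinuousLinearMap.proj (R := ℝ) (φ := fun _ : Fin n => ℝ) j).comp
      (ContinuousLinearMap.snd ℝ (E n) (E n))).hasFDerivAt
  rw [this.fderiv]
  simp

/-- derivative along `t ↦ y + t v` -/
theorem SA_line (hW : IsOpen W) (a : SA W) (p : W) (v : E n) :
    HasDerivAt (fun t : ℝ => extz W a.1 (p.1.1, p.1.2 + t • v))
      (∑ i, v i * ev p (dd hW ((0 : E n), e n i) a)) 0 := by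
  have hd := (SA_differentiable hW a p).hasFDerivAt
  have hl : HasDerivAt (fun t : ℝ => ((p.1.1, p.1.2 + t • v) : E n × E n)) ((0 : E n), v) 0 := by
    apply HasDerivAt.prodMk
    · exact hasDerivAt_const _ _
    · have := ((hasDerivAt_id (0 : ℝ)).smul_const v).const_add p.1.2
      simpa using this
  have h0 : ((p.1.1, p.1.2 + (0 : ℝ) • v) : E n × E n) = p.1 := by simp
  have hd' : HasFDerivAt (extz W a.1) (fderiv ℝ (extz W a.1) p.1)
      ((p.1.1, p.1.2 + (0 : ℝ) • v) : E n × E n) := by rw [h0]; exact hd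
  have h := hd'.comp_hasDerivAt (0 : ℝ) hl
  have hv : ((0 : E n), v) = ∑ i, v i • ((0 : E n), e n i) := by
    apply Prod.ext
    · simp [Prod.fst_sum]
    · simp only [Prod.snd_sum, Prod.smul_snd]
      funext j
      simp [e, Finset.sum_apply, Pi.single_apply]
  have hval : fderiv ℝ (extz W a.1) p.1 ((0 : E n), v)
      = ∑ i, v i * ev p (dd hW ((0 : E n), e n i) a) := by
    rw [hv, map_sum]
    simp only [map_smul, smul_eq_mul]
    rfl
  rw [hval] at h
  exact h

end Rep

theorem pr_zero_left {n : ℕ} {A : Type*} [CommRing A] (g : Fin n → A) :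
    pr (fun _ => (0 : A)) g = 0 := by
  simp [pr]

theorem sum_der_apply {n : ℕ} {A : Type*} [CommRing A] [Algebra ℝ A] (c : Fin n → A)
    (D : Fin n → Derivation ℝ A A) (a : A) :
    (∑ m, c m • D m) a = pr c (fun m => D m a) := by
  simp only [pr]
  rw [← Derivation.coeFnAddMonoidHom_apply, map_sum, Finset.sum_apply]
  rfl

namespace Sys

variable {n : ℕ} {A : Type*} [CommRing A] [Algebra ℝ A] (s : Sys n A)

/-- derivative in a constant direction -/
def Dv (v : Fin n → ℝ) : Derivation ℝ A A := ∑ m, algebraMap ℝ A (v m) • s.Dy m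

/-- constant vector -/
def cv (A : Type*) [CommRing A] [Algebra ℝ A] (v : Fin n → ℝ) : Fin n → A :=
  fun m => algebraMap ℝ A (v m)

theorem Dv_apply (v : Fin n → ℝ) (a : A) : s.Dv v a = pr (cv A v) (fun m => s.Dy m a) :=
  sum_der_apply _ _ _

theorem Dv_pr (v : Fin n → ℝ) (f : Fin n → A) :
    s.Dv v (pr (cv A v) f) = pr (cv A v) (fun m => s.Dv v (f m)) := by
  rw [pr_der]
  have : (fun m => s.Dv v (cv A v m)) = fun _ => 0 := by
    funext m; exact Derivation.map_algebraMap _ _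
  rw [this, pr_zero_left, zero_add]

def aR (v : Fin n → ℝ) : A :=
  pr (cv A v) (fun j => pr (cv A v) (fun k => pr (s.Q2 j) (s.R k)))

def BB (v : Fin n → ℝ) : A :=
  2 * (s.Q * pr (cv A v) (fun i => pr (cv A v) (s.Q2 i))) - pr (cv A v) s.Q1 * pr (cv A v) s.Q1

theorem Dv_aR (v : Fin n → ℝ) : s.Dv v (s.aR v) =
    pr (cv A v) (fun j => pr (cv A v) (fun k => pr (cv A v) (fun i =>
      pr (s.Q3 i j) (s.R k) + pr (s.Q2 j) (fun m => s.Dy i (s.R k m))))) := by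
  unfold aR
  simp only [Dv_pr]
  simp only [Dv_apply _ _ (pr _ _), pr_der, Dy_Q2]

theorem Dv_BB (v : Fin n → ℝ) : s.Dv v (s.BB v) =
    2 * (s.Q * pr (cv A v) (fun i => pr (cv A v) (fun j => pr (cv A v) (s.Q3 i j)))) := by
  have h1 : s.Dv v s.Q = pr (cv A v) s.Q1 := s.Dv_apply v _
  have h2 : s.Dv v (pr (cv A v) s.Q1) = pr (cv A v) (fun i => pr (cv A v) (s.Q2 i)) := by
    rw [Dv_pr]; simp only [Dv_apply, Q2_as]
  have h3 : s.Dv v (pr (cv A v) (fun i => pr (cv A v) (s.Q2 i)))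
      = pr (cv A v) (fun i => pr (cv A v) (fun j => pr (cv A v) (s.Q3 i j))) := by
    rw [Dv_pr]
    have : ∀ i, s.Dv v (pr (cv A v) (s.Q2 i)) = pr (cv A v) (fun j => pr (cv A v) (s.Q3 i j)) := by
      intro i
      rw [Dv_pr]
      congr 1; funext j
      rw [Dv_apply, Q3_as, Q3_comm]
    simp only [this]
  unfold BB
  rw [map_sub, two_der, Derivation.leibniz, Derivation.leibniz, h1, h2, h3]
  simp only [smul_eq_mul]
  ring

end Sys

theorem pr_rot {n : ℕ} (v : Fin n → ℝ) (T : Fin n → Fin n → Fin n → ℝ) :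
    pr v (fun i => pr v (fun j => pr v (fun k => T j k i)))
      = pr v (fun i => pr v (fun j => pr v (fun k => T i j k))) := by
  simp only [pr, Finset.mul_sum]
  rw [Finset.sum_comm]
  refine Finset.sum_congr rfl fun j _ => ?_
  rw [Finset.sum_comm]
  refine Finset.sum_congr rfl fun k _ => ?_
  refine Finset.sum_congr rfl fun i _ => ?_
  ring

theorem real_final {n : ℕ} (c Fs : ℝ) (hc : c ≠ 0) (v I I00 f : Fin n → ℝ)
    (h r q2 : Fin n → Fin n → ℝ)
    (q3 dr P : Fin n → Fin n → Fin n → ℝ)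
    (hsym : ∀ i j, h i j = h j i)
    (hq3 : ∀ i j k, q3 i j k = c * (h i j * I k + h j k * I i + h k i * I j))
    (hq2 : ∀ i j, q2 i j = h i j + 2 * (f i * f j))
    (hfr : ∀ k, pr f (r k) = 0)
    (hP : ∀ i j k, P i j k = -(pr (q3 i j) (r k) + pr (q2 i) (dr j k) + pr (q2 j) (dr i k)))
    (hmain : ∀ i j k, (3 * c) * (h i j * I00 k + h j k * I00 i + h k i * I00 j)
      = P i j k + P j k i + P k i j)
    (hFs : Fs ≠ 0) (hne : pr v (fun i => pr v (h i)) ≠ 0)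
    (hX : pr v (fun j => pr v (fun k => pr v (fun i => pr (q3 i j) (r k) + pr (q2 j) (dr i k))))
        * (2 * (Fs * pr v (fun i => pr v (h i))))
      = pr v (fun j => pr v (fun k => pr (q2 j) (r k))) *
        (2 * (Fs * pr v (fun i => pr v (fun j => pr v (q3 i j)))))) :
    pr v (fun i => pr v (h i)) * (pr I (fun m => pr v (fun k => r k m)) - 3 * pr v I00)
      = 4 * pr v (fun j => pr v (fun k => pr (q2 j) (r k))) * pr v I := by
  set hv := pr v (fun i => pr v (h i)) with hhv
  set w : Fin n → ℝ := fun m => pr v (fun k => r k m) with hw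
  set a := pr v (fun j => pr v (fun k => pr (q2 j) (r k))) with ha
  have hpw : ∀ g : Fin n → ℝ, pr v (fun k => pr g (r k)) = pr g w := by
    intro g
    have := pr_swap v g r
    rw [← this]
    congr 1; funext k; rw [pr_comm]
  have hfw : pr f w = 0 := by
    rw [← hpw]; simp only [hfr]; simp [pr]
  have hhw : pr v (fun j => pr w (h j)) = a := by
    rw [ha]; simp only [hpw]
    congr 1; funext j
    have : q2 j = fun m => h j m + 2 * (f j * f m) := funext fun m => hq2 j m
    rw [this, pr_comm _ w, pr_add, pr_mul', pr_mul', pr_comm w f,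
      hfw]
    ring
  have hq3v : pr v (fun i => pr v (fun j => pr v (q3 i j))) = 3 * c * hv * pr v I := by
    have e1 : ∀ i j, q3 i j = fun k => c * (h i j * I k + h j k * I i + h i k * I j) := by
      intro i j; funext k; rw [hq3, hsym k i]
    simp only [e1, pr_mul', pr_add, pr_mul, pr_mul]
    have e2 : ∀ i, pr v (fun j => h i j * pr v I) = pr v (h i) * pr v I := fun i => pr_mul _ _ _
    have e3 : ∀ i, pr v (fun j => pr v (h i) * I j) = pr v (h i) * pr v I := fun i => pr_mul' _ _ _
    rw [← hhv]
    ring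
  have hq3w : pr v (fun i => pr v (fun j => pr v (fun k => pr (q3 i j) (r k))))
      = c * (hv * pr I w + 2 * a * pr v I) := by
    have e1 : ∀ i j, q3 i j = fun k => c * (h i j * I k + h j k * I i + h i k * I j) := by
      intro i j; funext k; rw [hq3, hsym k i]
    have e2 : ∀ i j, pr (q3 i j) w = c * (h i j * pr w I + pr w (h j) * I i + pr w (h i) * I j) := by
      intro i j
      rw [e1, pr_comm]
      simp only [pr_mul', pr_add, pr_mul]
    simp only [hpw, e2]
    simp only [pr_mul', pr_add, pr_mul, hhw]
    rw [← hhv, pr_comm w I]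
    ring
  -- the two parts of X
  set Y := pr v (fun i => pr v (fun j => pr v (fun k => pr (q2 i) (dr j k)))) with hY
  have hXe : pr v (fun j => pr v (fun k => pr v (fun i => pr (q3 i j) (r k) + pr (q2 j) (dr i k))))
      = c * (hv * pr I w + 2 * a * pr v I) + Y := by
    simp only [pr_add]
    rw [pr_rot v (fun i j k => pr (q3 i j) (r k)) |>.symm] at hq3w
    rw [pr_rot v (fun i j k => pr (q3 j k) (r i)) |>.symm] at hq3w
    have s1 : pr v (fun j => pr v (fun k => pr v (fun i => pr (q3 i j) (r k))))
      = c * (hv * pr I w + 2 * a * pr v I) := by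
      rw [← hq3w]
    rw [s1]
    congr 1
    rw [hY]
    congr 1; funext j
    simp only [pr, Finset.mul_sum]
    rw [Finset.sum_comm]
    refine Finset.sum_congr rfl fun k _ => ?_
    refine Finset.sum_congr rfl fun i _ => ?_
    refine Finset.sum_congr rfl fun m _ => ?_
    ring
  have hPv : pr v (fun i => pr v (fun j => pr v (fun k => P i j k)))
      = -(c * (hv * pr I w + 2 * a * pr v I) + Y + Y) := by
    simp only [hP, pr_neg, pr_add]
    rw [hq3w, ← hY]
    have : pr v (fun i => pr v (fun j => pr v (fun k => pr (q2 j) (dr i k)))) = Y := by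
      rw [hY]
      simp only [pr, Finset.mul_sum]
      rw [Finset.sum_comm]
      refine Finset.sum_congr rfl fun k _ => ?_
      refine Finset.sum_congr rfl fun i _ => ?_
      refine Finset.sum_congr rfl fun m _ => ?_
      refine Finset.sum_congr rfl fun m _ => ?_
      ring
    rw [this]
  have hm : (3 * c) * (3 * (hv * pr v I00))
      = 3 * pr v (fun i => pr v (fun j => pr v (fun k => P i j k))) := by
    have e0 : pr v (fun i => pr v (fun j => pr v (fun k =>
        (3 * c) * (h i j * I00 k + h j k * I00 i + h i k * I00 j))))
        = (3 * c) * (3 * (hv * pr v I00)) := by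
      simp only [pr_mul', pr_add, pr_mul]
      rw [← hhv]
      ring
    rw [← e0]
    have e1 : ∀ i j k, (3 * c) * (h i j * I00 k + h j k * I00 i + h i k * I00 j)
      = P i j k + P j k i + P k i j := fun i j k => by rw [← hmain, hsym k i]
    simp only [e1, pr_add]
    have r1 := pr_rot v P
    have r2 := pr_rot v (fun i j k => P j k i)
    rw [r2, r1]
    ring
  rw [hq3v, hXe] at hX
  have hX' : c * (hv * pr I w + 2 * a * pr v I) + Y = 3 * c * a * pr v I := by
    have : (2 * (Fs * hv)) ≠ 0 := by positivity
    apply mul_right_cancel₀ this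
    linear_combination hX
  rw [hPv] at hm
  apply mul_left_cancel₀ hc
  linear_combination (-1/3) * hm + 2 * hX'

section Inst
variable {n : ℕ} {W : Set (E n × E n)}

/-- fibre derivation -/
def dY (hW : IsOpen W) (i : Fin n) : Derivation ℝ (SA W) (SA W) := dd hW ((0 : E n), e n i)
/-- base derivation -/
def dX (hW : IsOpen W) (i : Fin n) : Derivation ℝ (SA W) (SA W) := dd hW (e n i, (0 : E n))

def gA (hW : IsOpen W) (Fa : SA W) : Matrix (Fin n) (Fin n) (SA W) :=
  Matrix.of fun i j => (1 / 2 : ℝ) • dY hW i (dY hW j (Fa ^ 2))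

def GA (hW : IsOpen W) (Fa : SA W) (i : Fin n) : SA W :=
  (1 / 4 : ℝ) • ∑ l, (gA hW Fa)⁻¹ i l *
    ((∑ k, dX hW k (dY hW l (Fa ^ 2)) * yc W k) - dX hW l (Fa ^ 2))

theorem GA_EL (hW : IsOpen W) (Fa : SA W) (hdet : IsUnit (gA hW Fa).det) (i : Fin n) :
    2 * ∑ l, dY hW l (dY hW i (Fa ^ 2)) * GA hW Fa l
    = (∑ k, yc W k * dX hW k (dY hW i (Fa ^ 2))) - dX hW i (Fa ^ 2) := by
  set b : Fin n → SA W := fun l =>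
    (∑ k, dX hW k (dY hW l (Fa ^ 2)) * yc W k) - dX hW l (Fa ^ 2) with hb
  have h1 : ((gA hW Fa).mulVec ((gA hW Fa)⁻¹.mulVec b)) i = b i := by
    rw [Matrix.mulVec_mulVec, Matrix.mul_nonsing_inv _ hdet, Matrix.one_mulVec]
  have h2 : (∑ k, yc W k * dX hW k (dY hW i (Fa ^ 2))) - dX hW i (Fa ^ 2) = b i := by
    simp only [hb]
    congr 1
    exact Finset.sum_congr rfl fun k _ => mul_comm _ _
  have h3 : ∀ l, GA hW Fa l = (1 / 4 : ℝ) • ((gA hW Fa)⁻¹.mulVec b) l := by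
    intro l; rfl
  have h4 : ∀ l, dY hW l (dY hW i (Fa ^ 2)) = (2 : ℝ) • gA hW Fa i l := by
    intro l
    simp only [gA, Matrix.of_apply, smul_smul]
    rw [dY, dY, dd_comm]
    norm_num
  rw [h2, ← h1]
  simp only [h3, h4]
  rw [Matrix.mulVec, dotProduct, Finset.mul_sum]
  refine Finset.sum_congr rfl fun l _ => ?_
  rw [show (2 : SA W) = algebraMap ℝ (SA W) 2 from (map_ofNat (algebraMap ℝ (SA W)) 2).symm]
  rw [← Algebra.smul_def, smul_mul_smul_comm, smul_smul]
  norm_num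

/-- the system attached to a metric -/
def mkSys (hW : IsOpen W) (Fa : SA W) (hu : IsUnit Fa) (he : ∑ i, yc W i * dY hW i Fa = Fa)
    (hdet : IsUnit (gA hW Fa).det) : Sys n (SA W) where
  Dx := dX hW
  Dy := dY hW
  y := yc W
  G := GA hW Fa
  F := Fa
  cyy := fun _ _ a => dd_comm hW _ _ a
  cxy := fun _ _ a => dd_comm hW _ _ a
  cxx := fun _ _ a => dd_comm hW _ _ a
  yy := yc_y hW
  xy := yc_x hW
  uF := hu
  euler := he
  EL := GA_EL hW Fa hdet

theorem Rep.F2 {F : E n → E n → ℝ} {Fa : SA W} (h : Rep F Fa) : Rep (F2 n F) (Fa ^ 2) := by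
  intro p
  rw [map_pow, ← h p]; rfl

theorem Rep.gm (hW : IsOpen W) {F : E n → E n → ℝ} {Fa : SA W} (h : Rep F Fa) (i j : Fin n) :
    Rep (gm n F i j) (gA hW Fa i j) := by
  intro p
  have := ((h.F2.pdy hW j).pdy hW i) p
  simp only [Paper.gm, gA, Matrix.of_apply, map_smul, smul_eq_mul]
  rw [this]; rfl

theorem gmat_eq (hW : IsOpen W) {F : E n → E n → ℝ} {Fa : SA W} (h : Rep F Fa) (p : W) :
    gmat n F p.1.1 p.1.2 = (gA hW Fa).map (ev p) := by
  ext i j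
  simp only [gmat, Matrix.of_apply, Matrix.map_apply]
  exact h.gm hW i j p

theorem gA_det (hW : IsOpen W) {F : E n → E n → ℝ} {Fa : SA W} (h : Rep F Fa)
    (hp : ∀ p : W, (gmat n F p.1.1 p.1.2).PosDef) : IsUnit (gA hW Fa).det := by
  apply SA_isUnit
  intro p
  have h1 : ((gA hW Fa).det).1 p = ((gA hW Fa).map (ev p)).det := by
    have := (ev p).map_det (gA hW Fa)
    rw [← ev_apply, this]; rfl
  rw [h1, ← gmat_eq hW h]
  exact (hp p).det_pos.ne'

theorem Rep.ginv (hW : IsOpen W) {F : E n → E n → ℝ} {Fa : SA W} (h : Rep F Fa)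
    (hdet : IsUnit (gA hW Fa).det) (i j : Fin n) :
    Rep (fun x y => ginv n F x y i j) ((gA hW Fa)⁻¹ i j) := by
  intro p
  have h1 : gmat n F p.1.1 p.1.2 * ((gA hW Fa)⁻¹).map (ev p) = 1 := by
    rw [gmat_eq hW h, ← Matrix.map_mul, Matrix.mul_nonsing_inv _ hdet]
    exact Matrix.map_one _ (map_zero _) (map_one _)
  simp only [Paper.ginv]
  rw [Matrix.inv_eq_right_inv h1]
  rfl

theorem Rep.Spray (hW : IsOpen W) {F : E n → E n → ℝ} {Fa : SA W} (h : Rep F Fa)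
    (hdet : IsUnit (gA hW Fa).det) (i : Fin n) : Rep (Spray n F i) (GA hW Fa i) := by
  intro p
  simp only [Paper.Spray, GA, map_smul, map_sum, map_mul, map_sub, smul_eq_mul, yc_ev]
  have h1 : ∀ l, Paper.ginv n F p.1.1 p.1.2 i l = ev p ((gA hW Fa)⁻¹ i l) :=
    fun l => h.ginv hW hdet i l p
  have h2 : ∀ l k, Paper.pdx n (Paper.pdy n (Paper.F2 n F) l) k p.1.1 p.1.2
      = ev p (dX hW k (dY hW l (Fa ^ 2))) := fun l k => ((h.F2.pdy hW l).pdx hW k) p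
  have h3 : ∀ l, Paper.pdx n (Paper.F2 n F) l p.1.1 p.1.2 = ev p (dX hW l (Fa ^ 2)) :=
    fun l => (h.F2.pdx hW l) p
  simp only [h1, h2, h3]

variable (hW : IsOpen W) {F : E n → E n → ℝ} {Fa : SA W}
  (hu : IsUnit Fa) (he : ∑ i, yc W i * dY hW i Fa = Fa)
  (hdet : IsUnit (gA hW Fa).det)

theorem ev_pr (p : W) (f g : Fin n → SA W) :
    ev p (pr f g) = pr (fun m => ev p (f m)) (fun m => ev p (g m)) := by
  simp [pr]

theorem Rep.Riem (h : Rep F Fa) (k m : Fin n) :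
    Rep (RiemUp n F m k) ((mkSys hW Fa hu he hdet).R k m) := by
  intro p
  have hG : ∀ i, Rep (Paper.Spray n F i) (GA hW Fa i) := fun i => h.Spray hW hdet i
  have h1 := ((hG m).pdx hW k) p
  have h2 : ∀ j, Paper.pdx n (Paper.pdy n (Paper.Spray n F m) k) j p.1.1 p.1.2 = _ :=
    fun j => (((hG m).pdy hW k).pdx hW j) p
  have h3 : ∀ j, Paper.pdy n (Paper.pdy n (Paper.Spray n F m) k) j p.1.1 p.1.2 = _ :=
    fun j => (((hG m).pdy hW k).pdy hW j) p
  have h4 : ∀ i j, Paper.pdy n (Paper.Spray n F i) j p.1.1 p.1.2 = _ :=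
    fun i j => ((hG i).pdy hW j) p
  have h5 : ∀ j, Paper.Spray n F j p.1.1 p.1.2 = _ := fun j => hG j p
  simp only [RiemUp, h1, h2, h3, h4, h5, Sys.R, Sys.S_apply, map_sub, map_mul, ev_pr, map_ofNat]
  simp only [pr, mkSys, Sys.N, yc_ev]
  simp only [dX, dY]
  ring

theorem Rep.Dyn1 (h : Rep F Fa) {T : Fin n → E n → E n → ℝ} {Ta : Fin n → SA W} (hT : ∀ i, Rep (T i) (Ta i))
    (i : Fin n) : Rep (Dyn1 n F T i) ((mkSys hW Fa hu he hdet).dyn1 Ta i) := by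
  intro p
  have hG : ∀ i, Rep (Paper.Spray n F i) (GA hW Fa i) := fun i => h.Spray hW hdet i
  have h1 : ∀ j, Paper.pdx n (T i) j p.1.1 p.1.2 = _ := fun j => ((hT i).pdx hW j) p
  have h2 : ∀ j, Paper.pdy n (T i) j p.1.1 p.1.2 = _ := fun j => ((hT i).pdy hW j) p
  have h4 : ∀ i j, Paper.pdy n (Paper.Spray n F i) j p.1.1 p.1.2 = _ :=
    fun i j => ((hG i).pdy hW j) p
  have h5 : ∀ j, Paper.Spray n F j p.1.1 p.1.2 = _ := fun j => hG j p
  have h6 : ∀ j, T j p.1.1 p.1.2 = _ := fun j => hT j p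
  simp only [Paper.Dyn1, Gop, h1, h2, h4, h5, h6, Sys.dyn1, Sys.S_apply, map_sub, map_mul, ev_pr,
    map_ofNat]
  simp only [pr, mkSys, Sys.N, yc_ev]
  simp only [dX, dY]

/-- mean Cartan tensor -/
def IA (i : Fin n) : SA W :=
  ∑ j, ∑ k, (gA hW Fa)⁻¹ j k * ((1 / 4 : ℝ) • (mkSys hW Fa hu he hdet).Q3 i j k)

theorem Rep.Cartan (h : Rep F Fa) (i j k : Fin n) :
    Rep (Cartan n F i j k) ((1 / 4 : ℝ) • (mkSys hW Fa hu he hdet).Q3 i j k) := by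
  intro p
  have := (((h.F2.pdy hW k).pdy hW j).pdy hW i) p
  simp only [Paper.Cartan, this, map_smul, smul_eq_mul]
  rfl

theorem Rep.mean (h : Rep F Fa) (i : Fin n) :
    Rep (meanCartan n F i) (IA hW hu he hdet i) := by
  intro p
  have h1 : ∀ j l, Paper.ginv n F p.1.1 p.1.2 j l = ev p ((gA hW Fa)⁻¹ j l) :=
    fun j l => h.ginv hW hdet j l p
  have h2 : ∀ j k, Paper.Cartan n F i j k p.1.1 p.1.2 = _ :=
    fun j k => (h.Cartan hW hu he hdet i j k) p
  simp only [meanCartan, IA, map_sum, map_mul, h1, h2]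

theorem Rep.hm (h : Rep F Fa) (i j : Fin n) :
    Rep (hm n F i j) ((1 / 2 : ℝ) • (mkSys hW Fa hu he hdet).H i j) := by
  intro p
  have h1 := h.gm hW i j p
  have h2 : ∀ j, Paper.pdy n F j p.1.1 p.1.2 = _ := fun j => (h.pdy hW j) p
  simp only [Paper.hm, Fy, h1, h2, Sys.H, gA, Matrix.of_apply, map_smul, smul_eq_mul, map_sub,
    map_mul, map_ofNat]
  simp only [mkSys, Sys.Q2, Sys.Q]
  simp only [dY]
  ring

theorem Rep.Rlow (h : Rep F Fa) (j k : Fin n) :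
    Rep (Rlow n F j k) ((1 / 2 : ℝ) • pr ((mkSys hW Fa hu he hdet).Q2 j)
      ((mkSys hW Fa hu he hdet).R k)) := by
  intro p
  have h1 : ∀ i, Paper.gm n F i j p.1.1 p.1.2 = _ := fun i => h.gm hW i j p
  have h2 : ∀ i, RiemUp n F i k p.1.1 p.1.2 = _ := fun i => h.Riem hW hu he hdet k i p
  simp only [Paper.Rlow, h1, h2, gA, Matrix.of_apply, map_smul, smul_eq_mul, ev_pr]
  rw [pr, Finset.mul_sum]
  refine Finset.sum_congr rfl fun i _ => ?_
  rw [Sys.Q2_symm]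
  simp only [Sys.Q2, Sys.Q, mkSys]
  ring

end Inst

namespace Sys

variable {n : ℕ} {A : Type*} [CommRing A] [Algebra ℝ A] (s : Sys n A)

theorem BB_eq (v : Fin n → ℝ) :
    s.BB v = 2 * (s.Q * pr (cv A v) (fun i => pr (cv A v) (s.H i))) := by
  have h1 : pr (cv A v) s.Q1 = 2 * s.F * pr (cv A v) (fun i => s.Dy i s.F) := by
    rw [← pr_mul']
    congr 1; funext i; exact s.Q1F i
  have h2 : ∀ i, pr (cv A v) (s.H i) = pr (cv A v) (s.Q2 i)
      - (2 * pr (cv A v) (fun i => s.Dy i s.F)) * s.Dy i s.F := by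
    intro i
    simp only [pr, H, Finset.mul_sum, Finset.sum_mul, ← Finset.sum_sub_distrib]
    exact Finset.sum_congr rfl fun k _ => by ring
  have h3 : pr (cv A v) (fun i => pr (cv A v) (s.H i)) =
      pr (cv A v) (fun i => pr (cv A v) (s.Q2 i))
      - (2 * pr (cv A v) (fun i => s.Dy i s.F)) * pr (cv A v) (fun i => s.Dy i s.F) := by
    simp only [h2]
    rw [pr_sub (cv A v) (fun i => pr (cv A v) (s.Q2 i)), pr_mul']
  rw [h3, BB, h1, Q]
  ring

theorem Hy (i : Fin n) : pr s.y (s.H i) = 0 := by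
  have h2 : pr s.y (s.H i) = pr s.y (s.Q2 i) - (2 * s.Dy i s.F) * pr s.y (fun i => s.Dy i s.F) := by
    simp only [pr, H, Finset.mul_sum, ← Finset.sum_sub_distrib]
    exact Finset.sum_congr rfl fun k _ => by ring
  have h3 : pr s.y (fun i => s.Dy i s.F) = s.F := s.euler
  rw [h2, euler2, h3, Q1F]
  ring

theorem Ry : pr s.y (fun j => pr s.y (fun k => pr (s.Q2 j) (s.R k))) = 0 := by
  have h1 : pr s.y (fun j => pr s.y (fun k => pr (s.Q2 j) (s.R k)))
      = pr s.y (fun k => pr s.y (fun j => pr (s.Q2 j) (s.R k))) := by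
    simp only [pr, Finset.mul_sum]
    rw [Finset.sum_comm]
    refine Finset.sum_congr rfl fun k _ => Finset.sum_congr rfl fun j _ =>
      Finset.sum_congr rfl fun m _ => by ring
  rw [h1]
  have h2 : ∀ k, pr s.y (fun j => pr (s.Q2 j) (s.R k)) = 0 := by
    intro k
    rw [pr_swap]
    have : (fun m => pr s.y (fun l => s.Q2 l m)) = s.Q1 := by
      funext m
      rw [← s.euler2 m]
      congr 1; funext l; exact s.Q2_symm _ _
    rw [this, pr_comm, Q1R]
  simp only [h2]
  simp only [pr, mul_zero, Finset.sum_const_zero]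

end Sys

theorem dsum {n : ℕ} (T : Fin n → Fin n → ℝ) (v : Fin n → ℝ) :
    ∑ i, ∑ j, T i j * v i * v j = pr v (fun i => pr v (T i)) := by
  simp only [pr, Finset.mul_sum]
  refine Finset.sum_congr rfl fun k _ => Finset.sum_congr rfl fun j _ => by ring

theorem pos_final {n : ℕ} (q2 : Fin n → Fin n → ℝ) (q1 y v : Fin n → ℝ) (Q : ℝ)
    (hs : ∀ i j, q2 i j = q2 j i) (h1 : ∀ i, pr y (q2 i) = q1 i) (h0 : pr y q1 = 2 * Q)
    (hQ : 0 < Q) (hp : ∀ w : Fin n → ℝ, w ≠ 0 → 0 < pr w (fun i => pr w (q2 i)))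
    (hli : LinearIndependent ℝ ![y, v]) :
    0 < 2 * (Q * pr v (fun i => pr v (q2 i))) - pr v q1 * pr v q1 := by
  set w : Fin n → ℝ := (pr v q1) • y + (-(2 * Q)) • v with hw
  have hw0 : w ≠ 0 := by
    intro h
    have := (LinearIndependent.pair_iff.1 hli) _ _ h
    linarith [this.2]
  have h2 := hp w hw0
  have lin : ∀ (f g z : Fin n → ℝ) (a b : ℝ), pr (a • f + b • g) z = a * pr f z + b * pr g z := by
    intro f g z a b
    simp only [pr, Finset.mul_sum, ← Finset.sum_add_distrib]
    exact Finset.sum_congr rfl fun k _ => by simp; ring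
  have linr : ∀ (f z z' : Fin n → ℝ) (a b : ℝ),
      pr f (fun i => a * z i + b * z' i) = a * pr f z + b * pr f z' := by
    intro f g z a b
    simp only [pr, Finset.mul_sum, ← Finset.sum_add_distrib]
    exact Finset.sum_congr rfl fun k _ => by ring
  have e1 : pr w (fun i => pr w (q2 i)) = 
      (2 * Q) * (2 * (Q * pr v (fun i => pr v (q2 i))) - pr v q1 * pr v q1) := by
    rw [hw]
    simp only [lin, linr, h1]
    have e2 : pr y (fun i => pr v (q2 i)) = pr v q1 := by
      simp only [pr_comm v]
      rw [pr_swap, pr_comm q1]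
      congr 1; funext m
      rw [← h1]
      congr 1; funext l; exact hs _ _
    rw [h0, e2]
    ring
  rw [e1] at h2
  exact (mul_pos_iff_of_pos_left (by linarith)).1 h2

section Fin
variable {n : ℕ} {W : Set (E n × E n)}
variable (hW : IsOpen W) {F : E n → E n → ℝ} {Fa : SA W}
  (hu : IsUnit Fa) (he : ∑ i, yc W i * dY hW i Fa = Fa)
  (hdet : IsUnit (gA hW Fa).det)

theorem ev_cv (p : W) (v : Fin n → ℝ) : (fun m => ev p (Sys.cv (SA W) v m)) = v := by
  funext m
  simp [Sys.cv]

theorem ev_prv (p : W) (v : Fin n → ℝ) (g : Fin n → SA W) :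
    ev p (pr (Sys.cv (SA W) v) g) = pr v (fun m => ev p (g m)) := by
  rw [ev_pr, ev_cv]

theorem hm_sum (h : Rep F Fa) (p : W) (v : E n) :
    ∑ i, ∑ j, hm n F i j p.1.1 p.1.2 * v i * v j
      = 1 / 2 * pr v (fun i => pr v (fun j => ev p ((mkSys hW Fa hu he hdet).H i j))) := by
  rw [← dsum]
  simp only [Finset.mul_sum]
  refine Finset.sum_congr rfl fun i _ => Finset.sum_congr rfl fun j _ => ?_
  rw [h.hm hW hu he hdet i j p, map_smul, smul_eq_mul]; ring

theorem Rlow_sum (h : Rep F Fa) (p : W) (v : E n) :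
    ∑ i, ∑ j, Rlow n F i j p.1.1 p.1.2 * v i * v j
      = 1 / 2 * ev p ((mkSys hW Fa hu he hdet).aR v) := by
  rw [Sys.aR, ev_prv]
  simp only [ev_prv]
  rw [← dsum]
  simp only [Finset.mul_sum]
  refine Finset.sum_congr rfl fun i _ => Finset.sum_congr rfl fun j _ => ?_
  rw [h.Rlow hW hu he hdet i j p, map_smul, smul_eq_mul]; ring

theorem K_eq (h : Rep F Fa) (p : W) (v : E n) :
    K n F p.1.1 p.1.2 v = (1 / 2 * ev p ((mkSys hW Fa hu he hdet).aR v)) /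
      (1 / 4 * ev p ((mkSys hW Fa hu he hdet).BB v)) := by
  rw [K, Rlow_sum hW hu he hdet h, hm_sum hW hu he hdet h, h p, Sys.BB_eq, map_mul, map_mul, ev_prv]
  simp only [ev_prv, map_ofNat]
  congr 1
  have : ev p (mkSys hW Fa hu he hdet).Q = (ev p Fa) ^ 2 := map_pow _ _ _
  rw [this]
  ring

theorem BB_pos (h : Rep F Fa) (p : W) (hp : (gmat n F p.1.1 p.1.2).PosDef) (v : E n)
    (hv : LinearIndependent ℝ ![p.1.2, v]) : 0 < ev p ((mkSys hW Fa hu he hdet).BB v) := by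
  set s := mkSys hW Fa hu he hdet with hs
  rw [Sys.BB, map_sub, map_mul, map_mul, map_mul, ev_prv, ev_prv]
  simp only [ev_prv, map_ofNat]
  have hy : (fun m => ev p (s.y m)) = p.1.2 := rfl
  refine pos_final (fun i j => ev p (s.Q2 i j)) _ p.1.2 v _ ?_ ?_ ?_ ?_ ?_ hv
  · intro i j; rw [s.Q2_symm]
  · intro i; rw [← s.euler2 i, ev_pr, hy]
  · rw [← hy, ← ev_pr, s.euler1, map_mul, map_ofNat]
  · have : ev p s.Q = (ev p Fa) ^ 2 := map_pow _ _ _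
    rw [this]
    have : ev p Fa ≠ 0 := (hu.map (ev p)).ne_zero
    positivity
  · intro w hw
    have h1 := hp.dotProduct_mulVec_pos hw
    rw [gmat_eq hW h] at h1
    have h2 : star w ⬝ᵥ ((gA hW Fa).map (ev p)).mulVec w
        = 1 / 2 * pr w (fun i => pr w (fun j => ev p (s.Q2 i j))) := by
      rw [← dsum]
      simp only [dotProduct, Matrix.mulVec, Finset.mul_sum, star_trivial]
      refine Finset.sum_congr rfl fun i _ => Finset.sum_congr rfl fun j _ => ?_
      simp only [gA, Matrix.map_apply, Matrix.of_apply, map_smul, smul_eq_mul]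
      simp only [hs, Sys.Q2, Sys.Q, mkSys]
      ring
    rw [h2] at h1
    linarith

theorem Dv_line (a : SA W) (p : W) (v : E n) :
    HasDerivAt (fun t : ℝ => extz W a.1 (p.1.1, p.1.2 + t • v))
      (ev p ((mkSys hW Fa hu he hdet).Dv v a)) 0 := by
  have := SA_line hW a p v
  rw [Sys.Dv_apply, ev_prv]
  exact this

theorem sec_diff (h : Rep F Fa) (hp : ∀ p : W, (gmat n F p.1.1 p.1.2).PosDef) 
    (p : W) (v : E n) (hv : LinearIndependent ℝ ![p.1.2, v])
    (hline : ∀ t : ℝ, (p.1.1, p.1.2 + t • v) ∈ W)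
    (hK : ∀ t : ℝ, K n F p.1.1 (p.1.2 + t • v) v = K n F p.1.1 p.1.2 v) :
    ev p ((mkSys hW Fa hu he hdet).Dv v ((mkSys hW Fa hu he hdet).aR v))
      * ev p ((mkSys hW Fa hu he hdet).BB v)
    = ev p ((mkSys hW Fa hu he hdet).aR v) *
      ev p ((mkSys hW Fa hu he hdet).Dv v ((mkSys hW Fa hu he hdet).BB v)) := by
  set s := mkSys hW Fa hu he hdet with hs
  have h1 := (Dv_line hW hu he hdet (s.aR v) p v).mul_const (ev p (s.BB v))
  have h2 := (Dv_line hW hu he hdet (s.BB v) p v).const_mul (ev p (s.aR v))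
  have h3 : (fun t : ℝ => extz W (s.aR v).1 (p.1.1, p.1.2 + t • v) * ev p (s.BB v))
      = fun t : ℝ => ev p (s.aR v) * extz W (s.BB v).1 (p.1.1, p.1.2 + t • v) := by
    funext t
    rw [extz_of_mem W _ (hline t), extz_of_mem W _ (hline t), ← ev_apply, ← ev_apply]
    have hli : LinearIndependent ℝ ![p.1.2 + t • v, v] :=
      (LinearIndependent.pair_add_smul_left_iff t).2 hv
    have b1 := BB_pos hW hu he hdet h p (hp p) v hv
    have b2 := BB_pos hW hu he hdet h ⟨_, hline t⟩ (hp _) v hli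
    have k1 := K_eq hW hu he hdet h p v
    have k2 := K_eq hW hu he hdet h ⟨_, hline t⟩ v
    have k3 := hK t
    simp only at k2
    rw [k1, k2, div_eq_div_iff (by positivity) (by positivity)] at k3
    linarith
  rw [h3] at h1
  exact h1.unique h2

end Fin

section Core
variable {n : ℕ} {W : Set (E n × E n)}

theorem euler_of (hW : IsOpen W) {F : E n → E n → ℝ} {Fa : SA W} (h : Rep F Fa)
    (hhom : ∀ p : W, ∀ c : ℝ, 0 < c →
      (p.1.1, c • p.1.2) ∈ W ∧ F p.1.1 (c • p.1.2) = c * F p.1.1 p.1.2) :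
    ∑ i, yc W i * dY hW i Fa = Fa := by
  apply SA_ext
  intro p
  rw [map_sum]
  simp only [map_mul, yc_ev]
  have h1 := SA_line hW Fa p p.1.2
  have h2 : HasDerivAt (fun t : ℝ => (1 + t) * ev p Fa) (1 * ev p Fa) 0 :=
    ((hasDerivAt_id (0 : ℝ)).const_add 1).mul_const _
  have h3 : (fun t : ℝ => extz W Fa.1 (p.1.1, p.1.2 + t • p.1.2)) =ᶠ[nhds 0]
      fun t : ℝ => (1 + t) * ev p Fa := by
    filter_upwards [lt_mem_nhds (show (-1 : ℝ) < 0 by norm_num)] with t ht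
    have h4 := hhom p (1 + t) (by linarith)
    have h5 : p.1.2 + t • p.1.2 = (1 + t) • p.1.2 := by rw [add_smul, one_smul]
    rw [h5, extz_of_mem W _ h4.1, ← ev_apply, ← h ⟨_, h4.1⟩, ← h p]
    exact h4.2
  have h6 := h1.unique (h2.congr_of_eventuallyEq h3)
  rw [one_mul] at h6
  exact h6

theorem Q3_of (hW : IsOpen W) {F : E n → E n → ℝ} {Fa : SA W}
    (hu : IsUnit Fa) (he : ∑ i, yc W i * dY hW i Fa = Fa)
    (hdet : IsUnit (gA hW Fa).det)
    (h : Rep F Fa)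
    (hM : ∀ p : W, ∀ i j k : Fin n, Matsumoto n F i j k p.1.1 p.1.2 = 0) (i j k : Fin n) :
    (mkSys hW Fa hu he hdet).Q3 i j k =
      (2 / ((n : ℝ) + 1)) • (mkSys hW Fa hu he hdet).sym (IA hW hu he hdet) i j k := by
  apply SA_ext
  intro p
  have h1 := hM p i j k
  rw [Matsumoto] at h1
  rw [h.Cartan hW hu he hdet i j k p, h.hm hW hu he hdet i j p, h.hm hW hu he hdet j k p,
    h.hm hW hu he hdet k i p, h.mean hW hu he hdet i p, h.mean hW hu he hdet j p,
    h.mean hW hu he hdet k p] at h1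
  simp only [map_smul, smul_eq_mul] at h1
  simp only [map_smul, smul_eq_mul, Sys.sym, map_add, map_mul]
  rw [div_eq_mul_one_div]
  linarith

theorem core (hW : IsOpen W) {F : E n → E n → ℝ} {Fa : SA W}
    (hu : IsUnit Fa) (he : ∑ i, yc W i * dY hW i Fa = Fa)
    (hdet : IsUnit (gA hW Fa).det)
    (h : Rep F Fa) (hp : ∀ p : W, (gmat n F p.1.1 p.1.2).PosDef)
    (hM : ∀ p : W, ∀ i j k : Fin n, Matsumoto n F i j k p.1.1 p.1.2 = 0)
    (p : W) (v : E n) (hv : LinearIndependent ℝ ![p.1.2, v])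
    (hline : ∀ t : ℝ, (p.1.1, p.1.2 + t • v) ∈ W)
    (hK : ∀ t : ℝ, K n F p.1.1 (p.1.2 + t • v) v = K n F p.1.1 p.1.2 v) :
    (∑ i, ∑ j, hm n F i j p.1.1 p.1.2 * v i * v j) *
        ((∑ m, meanCartan n F m p.1.1 p.1.2 * (∑ k, RiemUp n F m k p.1.1 p.1.2 * v k)) -
          3 * ∑ k, Dyn1 n F (Dyn1 n F (meanCartan n F)) k p.1.1 p.1.2 * v k) =
      4 * (∑ j, ∑ k, Rlow n F j k p.1.1 p.1.2 * v j * v k) *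
        (∑ k, meanCartan n F k p.1.1 p.1.2 * v k) := by
  have hsd := sec_diff hW hu he hdet h hp p v hv hline hK
  have hB := BB_pos hW hu he hdet h p (hp p) v hv
  have hQ3 := Q3_of hW hu he hdet h hM
  have hhm := hm_sum hW hu he hdet h p v
  have hRl := Rlow_sum hW hu he hdet h p v
  have hI : ∀ k, meanCartan n F k p.1.1 p.1.2 = _ := fun k => h.mean hW hu he hdet k p
  have hI0 : ∀ k, Dyn1 n F (Dyn1 n F (meanCartan n F)) k p.1.1 p.1.2 = _ := fun k =>
    h.Dyn1 hW hu he hdet (h.Dyn1 hW hu he hdet (h.mean hW hu he hdet)) k p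
  have hR : ∀ m k, RiemUp n F m k p.1.1 p.1.2 = _ := fun m k => h.Riem hW hu he hdet k m p
  rw [hhm, hRl]
  simp only [hI, hI0, hR]
  have hFne : ev p Fa ≠ 0 := (hu.map (ev p)).ne_zero
  have hFs : (mkSys hW Fa hu he hdet).F = Fa := rfl
  generalize mkSys hW Fa hu he hdet = s at *
  generalize IA hW hu he hdet = T at *
  rw [s.Dv_aR, s.Dv_BB] at hsd
  rw [s.BB_eq] at hsd hB
  simp only [Sys.aR, map_mul, map_add, ev_pr, ev_cv, map_ofNat] at hsd hB ⊢
  have hmain := s.main2 _ T hQ3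
  have hQne : ev p s.Q ≠ 0 := by
    intro h0; rw [h0] at hB; simp at hB
  have hne : pr v (fun i => pr v (fun j => ev p (s.H i j))) ≠ 0 := by
    intro h0; rw [h0] at hB; simp at hB
  have hc : (2 / ((n : ℝ) + 1)) ≠ 0 := by positivity
  have key := real_final (2 / ((n : ℝ) + 1)) (ev p s.Q) hc v (fun k => ev p (T k))
    (fun k => ev p (s.dyn1 (s.dyn1 T) k)) (fun i => ev p (s.Dy i s.F))
    (fun i j => ev p (s.H i j)) (fun k m => ev p (s.R k m)) (fun i j => ev p (s.Q2 i j))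
    (fun i j k => ev p (s.Q3 i j k)) (fun i k m => ev p (s.Dy i (s.R k m)))
    (fun i j k => ev p (s.P i j k))
    (fun i j => by rw [s.H_symm])
    (fun i j k => by
      rw [hQ3]; simp only [map_smul, smul_eq_mul, Sys.sym, map_add, map_mul])
    (fun i j => by
      simp only [Sys.H, map_sub, map_mul, map_ofNat]; ring)
    (fun k => by
      have h1 := congrArg (ev p) (s.Q1R k)
      have h2 : s.Q1 = fun i => 2 * s.F * s.Dy i s.F := funext s.Q1F
      rw [h2, pr_comm, pr_mul', pr_comm, map_mul, map_mul, ev_pr, map_zero, map_ofNat] at h1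
      rcases mul_eq_zero.1 h1 with h3 | h3
      · exact absurd h3 (mul_ne_zero two_ne_zero (by rw [hFs]; exact hFne))
      · exact h3)
    (fun i j k => by
      simp only [Sys.P, map_neg, map_add, ev_pr])
    (fun i j k => by
      have h1 := congrArg (ev p) (hmain i j k)
      simp only [map_smul, smul_eq_mul, Sys.sym, map_add, map_mul] at h1
      exact h1)
    hQne hne hsd
  have e1 : (∑ m, ev p (T m) * ∑ k, ev p (s.R k m) * v k)
      = pr (fun k => ev p (T k)) (fun m => pr v (fun k => ev p (s.R k m))) := by
    simp only [pr, mul_comm (v _)]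
  have e2 : ∀ f : Fin n → ℝ, ∑ k, f k * v k = pr v f := by
    intro f
    simp only [pr, mul_comm (v _)]
  rw [e1, e2, e2]
  linarith

theorem degen (hW : IsOpen W) {F : E n → E n → ℝ} {Fa : SA W}
    (hu : IsUnit Fa) (he : ∑ i, yc W i * dY hW i Fa = Fa)
    (hdet : IsUnit (gA hW Fa).det)
    (h : Rep F Fa) (p : W) (a : ℝ) (v : E n) (hv : a • p.1.2 = v) :
    (∑ i, ∑ j, hm n F i j p.1.1 p.1.2 * v i * v j) = 0 ∧
    (∑ j, ∑ k, Rlow n F j k p.1.1 p.1.2 * v j * v k) = 0 := by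
  rw [hm_sum hW hu he hdet h, Rlow_sum hW hu he hdet h]
  set s := mkSys hW Fa hu he hdet
  have hy : (fun m => ev p (s.y m)) = p.1.2 := rfl
  have hl : ∀ g : Fin n → ℝ, pr v g = a * pr p.1.2 g := by
    intro g
    rw [← hv]
    simp only [pr, Finset.mul_sum, Pi.smul_apply, smul_eq_mul, mul_assoc]
  constructor
  · have h1 : ∀ i, pr p.1.2 (fun j => ev p (s.H i j)) = 0 := by
      intro i
      rw [← hy, ← ev_pr, s.Hy, map_zero]
    simp only [hl, h1, mul_zero]
    simp [pr]
  · have h1 := congrArg (ev p) s.Ry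
    simp only [ev_pr, hy, map_zero] at h1
    simp only [Sys.aR, ev_pr, ev_cv, hl]
    rw [pr_mul', h1]
    simp

end Core
/-- for a Finsler metric of sectional flag curvature with vanishing
Matsumoto torsion (n ≥ 3):
`h_y(v,v)·(I_m R^m_k v^k - 3 I_{k|0|0}v^k) = 4 R_y(v,v) I_y(v)`. -/
theorem matsumoto_free_identity (n : ℕ) (hn : 3 ≤ n)
    (U : Set (E n)) (hU : IsOpen U) (F : E n → E n → ℝ)
    (hF : IsFinsler n U F) (hsec : SectionalFlagCurv n U F)
    (hM : ∀ x ∈ U, ∀ y : E n, y ≠ 0 → ∀ i j k : Fin n, Matsumoto n F i j k x y = 0) :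
    ∀ x ∈ U, ∀ y : E n, y ≠ 0 → ∀ v : E n,
      (∑ i, ∑ j, hm n F i j x y * v i * v j) *
        ((∑ m, meanCartan n F m x y * (∑ k, RiemUp n F m k x y * v k)) -
          3 * ∑ k, Dyn1 n F (Dyn1 n F (meanCartan n F)) k x y * v k) =
      4 * (∑ j, ∑ k, Rlow n F j k x y * v j * v k) *
        (∑ k, meanCartan n F k x y * v k) := by
  have hW : IsOpen (U ×ˢ {y : E n | y ≠ 0}) := hU.prod isOpen_ne
  set W : Set (E n × E n) := U ×ˢ {y : E n | y ≠ 0} with hWdef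
  let Fa : SA W := ⟨fun p => F p.1.1 p.1.2,
    smooth_of W _ (fun q => F q.1 q.2) hF.smooth fun p => rfl⟩
  have h : Rep F Fa := fun p => rfl
  have hp : ∀ p : W, (gmat n F p.1.1 p.1.2).PosDef := fun p => hF.posdef _ p.2.1 _ p.2.2
  have hu : IsUnit Fa := SA_isUnit Fa fun p => (hF.pos _ p.2.1 _ p.2.2).ne'
  have he : ∑ i, yc W i * dY hW i Fa = Fa := by
    apply euler_of hW h
    intro p c hc
    exact ⟨⟨p.2.1, smul_ne_zero hc.ne' p.2.2⟩, hF.homog _ p.2.1 _ p.2.2 c hc⟩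
  have hdet : IsUnit (gA hW Fa).det := gA_det hW h hp
  intro x hx y hy v
  have hmem : (x, y) ∈ W := ⟨hx, hy⟩
  by_cases hv : LinearIndependent ℝ ![y, v]
  · have hli : ∀ t : ℝ, LinearIndependent ℝ ![y + t • v, v] := fun t =>
      (LinearIndependent.pair_add_smul_left_iff t).2 hv
    have hsp : ∀ t : ℝ, Submodule.span ℝ {y + t • v, v} = Submodule.span ℝ {y, v} := by
      intro t
      apply le_antisymm
      · rw [Submodule.span_le]
        rintro z (rfl | rfl)
        · exact Submodule.mem_span_pair.2 ⟨1, t, by simp⟩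
        · exact Submodule.mem_span_pair.2 ⟨0, 1, by simp⟩
      · rw [Submodule.span_le]
        rintro z (rfl | rfl)
        · exact Submodule.mem_span_pair.2 ⟨1, -t, by simp⟩
        · exact Submodule.mem_span_pair.2 ⟨0, 1, by simp⟩
    exact core hW hu he hdet h hp (fun p => hM _ p.2.1 _ p.2.2) ⟨(x, y), hmem⟩ v hv
      (fun t => ⟨hx, (hli t).ne_zero 0⟩)
      (fun t => hsec x hx _ _ _ _ (hli t) hv (hsp t))
  · have h1 : ∃ a : ℝ, a • y = v := by
      by_contra hcon
      push Not at hcon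
      exact hv ((LinearIndependent.pair_iff' hy).2 hcon)
    obtain ⟨a, ha⟩ := h1
    obtain ⟨d1, d2⟩ := degen hW hu he hdet h ⟨(x, y), hmem⟩ a v ha
    simp only at d1 d2
    rw [d1, d2]
    ring

end Paper
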